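/- Let H = (V, E) be a hypergraph, let p be a prime number, q ∈ ℕ with q ≥ 1, and set c = p^q. Let d ≥ c and s = d − (p−1)·p^{q−1}. Then disc(Δ^d H, c) ≤ disc(Δ^s H, c). -/

import Mathlib

/-- The Stirling numbers of the second kind: `stirling2 d k` is the number of
partitions of a `d`-element set into `k` nonempty parts. -/
def stirling2 : ℕ → ℕ → ℕ
  | 0, 0 => 1
  | 0, _ + 1 => 0
  | _ + 1, 0 => 0
  | d + 1, k + 1 => (k + 1) * stirling2 d (k + 1) + stirling2 d k

/-- The discrepancy of a `c`-coloring `χ` of the hypergraph with edge set `H`. -/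
noncomputable def discCol {V : Type} (H : Finset (Finset V)) (c : ℕ) (χ : V → Fin c) : ℝ :=
  ⨆ E ∈ H, ⨆ i : Fin c, |((E.filter fun v => χ v = i).card : ℝ) - (E.card : ℝ) / (c : ℝ)|

/-- The `c`-color discrepancy of the hypergraph with edge set `H`. -/
noncomputable def disc {V : Type} (H : Finset (Finset V)) (c : ℕ) : ℝ :=
  ⨅ χ : V → Fin c, discCol H c χ

/-- The `d`-fold symmetric product of a hypergraph: edge set `{E^d : E ∈ H}`
on the vertex set `V^d`. -/
def symProd {V : Type} [DecidableEq V] (H : Finset (Finset V)) (d : ℕ) :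
    Finset (Finset (Fin d → V)) :=
  H.image fun E => Fintype.piFinset fun _ : Fin d => E

/-- A permutation whose order divides `p ^ (n + 1)` admits a labelling by residues that
increases by one along every orbit of full length. -/
theorem exists_zmod_label {α : Type*} {p n : ℕ} (hp : p.Prime) (T : Equiv.Perm α)
    (hT : T ^ p ^ (n + 1) = 1) :
    ∃ κ : α → ZMod (p ^ (n + 1)), ∀ x, (T ^ p ^ n) x ≠ x → κ (T x) = κ x + 1 := by
  classical
  let S : Setoid α := Equiv.Perm.SameCycle.setoid T
  let rep : α → α := fun x => (Quotient.mk S x).out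
  have hrep : ∀ x, ∃ k : ℤ, (T ^ k) (rep x) = x := fun x =>
    show T.SameCycle (rep x) x from Quotient.exact (Quotient.out_eq (Quotient.mk S x))
  choose k hk using hrep
  refine ⟨fun x => (k x : ZMod (p ^ (n + 1))), fun x hx => ?_⟩
  have hTx : rep (T x) = rep x := by
    have : Quotient.mk S (T x) = Quotient.mk S x :=
      Quotient.sound (show T.SameCycle (T x) x from
        Equiv.Perm.sameCycle_apply_left.2 (Equiv.Perm.SameCycle.refl T x))
    simp only [rep, this]
  have hr : (T ^ p ^ n) (rep x) ≠ rep x := by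
    intro h
    apply hx
    conv_lhs => rw [← hk x]
    rw [← Equiv.Perm.mul_apply, ← zpow_natCast, zpow_mul_comm, Equiv.Perm.mul_apply,
      zpow_natCast, h, hk]
  have hper : Function.minimalPeriod T (rep x) = p ^ (n + 1) := by
    have := Fact.mk hp
    refine Function.minimalPeriod_eq_prime_pow ?_ ?_
    · rwa [Function.IsPeriodicPt, Function.IsFixedPt, ← Equiv.Perm.coe_pow]
    · rw [Function.IsPeriodicPt, Function.IsFixedPt, ← Equiv.Perm.coe_pow, hT]
      rfl
  have hfix : T ^ (k (T x) - (k x + 1)) • rep x = rep x := by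
    have h1 : (T ^ k (T x)) (rep x) = (T ^ (k x + 1)) (rep x) := by
      rw [add_comm, zpow_add, zpow_one, Equiv.Perm.mul_apply, hk, ← hTx, hk]
    rw [Equiv.Perm.smul_def, sub_eq_neg_add, zpow_add, Equiv.Perm.mul_apply, h1,
      ← Equiv.Perm.mul_apply, ← zpow_add, neg_add_cancel, zpow_zero, Equiv.Perm.one_apply]
  rw [MulAction.zpow_smul_eq_iff_period_dvd] at hfix
  have hper' : MulAction.period T (rep x) = p ^ (n + 1) := hper
  rw [hper', ← ZMod.intCast_zmod_eq_zero_iff_dvd] at hfix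
  push_cast at hfix
  exact sub_eq_zero.1 (by simpa using hfix)

/-- If a bijection of a finite set shifts the labels in `ZMod c` by one, all label classes
have the same size. -/
theorem card_mul_filter_label {α : Type*} {c : ℕ} [NeZero c] (S : Finset α) (T : Equiv.Perm α)
    (hS : ∀ x, T x ∈ S ↔ x ∈ S) (κ : α → ZMod c) (hκ : ∀ x ∈ S, κ (T x) = κ x + 1)
    (i : ZMod c) : c * (S.filter fun x => κ x = i).card = S.card := by
  have hstep : ∀ j : ZMod c,
      (S.filter fun x => κ x = j).card = (S.filter fun x => κ x = j + 1).card := by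
    intro j
    refine Finset.card_equiv T fun x => ?_
    simp only [Finset.mem_filter, hS]
    refine and_congr_right fun hx => ?_
    rw [hκ x hx, add_left_inj]
  have hnat : ∀ t : ℕ,
      (S.filter fun x => κ x = (t : ZMod c)).card = (S.filter fun x => κ x = 0).card := by
    intro t
    induction t with
    | zero => simp
    | succ t ih => rw [Nat.cast_succ, ← hstep, ih]
  have hall : ∀ j : ZMod c,
      (S.filter fun x => κ x = j).card = (S.filter fun x => κ x = 0).card := by
    intro j
    rw [← hnat j.val, ZMod.natCast_zmod_val]
  rw [Finset.card_eq_sum_card_fiberwise (s := S) (f := κ) (t := Finset.univ) (fun _ _ => by simp),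
    Finset.sum_congr rfl fun j _ => hall j, hall i]
  simp [ZMod.card]

/-- Cyclically rotating the first `p ^ (n + 1)` of `d` coordinates: the tuples fixed by the
`p ^ n`-fold rotation are those pulled back along a map `π` onto fewer coordinates. -/
theorem exists_rotation {p n d s : ℕ} (hp : p.Prime) (hd : p ^ (n + 1) ≤ d)
    (hs : s = d - (p - 1) * p ^ n) :
    ∃ (σ : Equiv.Perm (Fin d)) (π : Fin d → Fin s), σ ^ p ^ (n + 1) = 1 ∧
      Function.Surjective π ∧ (∀ a, π ((σ ^ p ^ n) a) = π a) ∧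
      ∀ a b, π a = π b → ∃ k : ℕ, ((σ ^ p ^ n) ^ k) a = b := by
  have := Fact.mk hp
  obtain ⟨r, rfl⟩ := Nat.exists_eq_add_of_le hd
  have hs' : s = p ^ n + r := by
    rw [hs, Nat.sub_mul, one_mul, ← pow_succ']
    have : p ^ n ≤ p ^ (n + 1) := Nat.pow_le_pow_right hp.pos n.le_succ
    omega
  subst hs'
  let e : ZMod (p ^ (n + 1)) ⊕ Fin r ≃ Fin (p ^ (n + 1) + r) :=
    Fintype.equivFinOfCardEq (by simp [ZMod.card])
  let e' : ZMod (p ^ n) ⊕ Fin r ≃ Fin (p ^ n + r) :=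
    Fintype.equivFinOfCardEq (by simp [ZMod.card])
  let τ : Equiv.Perm (ZMod (p ^ (n + 1)) ⊕ Fin r) :=
    Equiv.sumCongr (Equiv.addRight 1) (Equiv.refl _)
  have hdvd : p ^ n ∣ p ^ (n + 1) := pow_dvd_pow p n.le_succ
  let φ := ZMod.castHom hdvd (ZMod (p ^ n))
  have hτl : ∀ (k : ℕ) a, (τ ^ k) (Sum.inl a) = Sum.inl (a + k) := by
    intro k
    induction k with
    | zero => simp
    | succ k ih =>
      intro a
      rw [pow_succ' τ, Equiv.Perm.mul_apply, ih]
      simp [τ, add_assoc]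
  have hτr : ∀ (k : ℕ) b, (τ ^ k) (Sum.inr b) = Sum.inr b := by
    intro k
    induction k with
    | zero => simp
    | succ k ih =>
      intro b
      rw [pow_succ' τ, Equiv.Perm.mul_apply, ih]
      simp [τ]
  have hσ : ∀ (k : ℕ) x, ((e.permCongr τ) ^ k) x = e ((τ ^ k) (e.symm x)) := by
    intro k
    induction k with
    | zero => simp
    | succ k ih =>
      intro x
      rw [pow_succ' (e.permCongr τ), Equiv.Perm.mul_apply, ih, pow_succ' τ, Equiv.Perm.mul_apply]
      simp
  refine ⟨e.permCongr τ, fun x => e' (Sum.map φ id (e.symm x)), ?_, ?_, ?_, ?_⟩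
  · ext1 x
    rw [hσ]
    obtain ⟨y, rfl⟩ := e.surjective x
    rcases y with a | b
    · rw [e.symm_apply_apply, hτl, ZMod.natCast_self, add_zero, Equiv.Perm.one_apply]
    · rw [e.symm_apply_apply, hτr, Equiv.Perm.one_apply]
  · exact e'.surjective.comp
      (((ZMod.castHom_surjective hdvd).sumMap Function.surjective_id).comp e.symm.surjective)
  · intro x
    beta_reduce
    rw [hσ]
    obtain ⟨y, rfl⟩ := e.surjective x
    rcases y with a | b
    · have h0 : φ ((p ^ n : ℕ) : ZMod (p ^ (n + 1))) = 0 := by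
        rw [map_natCast, ZMod.natCast_self]
      rw [e.symm_apply_apply, e.symm_apply_apply, hτl, Sum.map_inl, map_add, h0, add_zero,
        Sum.map_inl]
    · rw [e.symm_apply_apply, e.symm_apply_apply, hτr]
  · intro x y hxy
    obtain ⟨x, rfl⟩ := e.surjective x
    obtain ⟨y, rfl⟩ := e.surjective y
    have h := e'.injective hxy
    simp only [e.symm_apply_apply] at h
    rcases x with a | a <;> rcases y with b | b
    · simp only [Sum.map_inl, Sum.inl.injEq] at h
      have h0 : φ (b - a) = 0 := by rw [map_sub, h, sub_self]
      have h1 : p ^ n ∣ (b - a).val := by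
        rw [← ZMod.natCast_eq_zero_iff, ← h0]
        conv_rhs => rw [← ZMod.natCast_zmod_val (b - a)]
        rw [map_natCast]
      obtain ⟨k, hk⟩ := h1
      refine ⟨k, ?_⟩
      rw [← pow_mul, ← hk, hσ, e.symm_apply_apply, hτl, ZMod.natCast_zmod_val,
        add_sub_cancel]
    · simp at h
    · simp at h
    · simp only [Sum.map_inr, Sum.inr.injEq, id] at h
      exact ⟨0, by simp [h]⟩

/-- Every colouring of `s`-tuples lifts to a colouring of `d`-tuples with the same signed
deviation on every cube. -/
theorem exists_lift_coloring {V : Type*} [DecidableEq V] {p n d s : ℕ} (hp : p.Prime)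
    (hd : p ^ (n + 1) ≤ d) (hs : s = d - (p - 1) * p ^ n)
    (χ : (Fin s → V) → Fin (p ^ (n + 1))) :
    ∃ χ' : (Fin d → V) → Fin (p ^ (n + 1)), ∀ (E : Finset V) (i : Fin (p ^ (n + 1))),
      (((Fintype.piFinset fun _ : Fin d => E).filter fun v => χ' v = i).card : ℝ)
          - ((Fintype.piFinset fun _ : Fin d => E).card : ℝ) / (p ^ (n + 1) : ℕ)
        = (((Fintype.piFinset fun _ : Fin s => E).filter fun v => χ v = i).card : ℝ)
          - ((Fintype.piFinset fun _ : Fin s => E).card : ℝ) / (p ^ (n + 1) : ℕ) := by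
  classical
  have := Fact.mk hp
  obtain ⟨σ, π, hσ, hπ, hinv, horb⟩ := exists_rotation hp hd hs
  let T : Equiv.Perm (Fin d → V) := Equiv.arrowCongr σ.symm (Equiv.refl V)
  have hT : ∀ (k : ℕ) f, (T ^ k) f = f ∘ (σ ^ k : Equiv.Perm (Fin d)) := by
    intro k
    induction k with
    | zero => intro f; rfl
    | succ k ih =>
      intro f
      rw [pow_succ', Equiv.Perm.mul_apply, ih, pow_succ]
      rfl
  have hT1 : T ^ p ^ (n + 1) = 1 := by
    ext1 f
    rw [hT, hσ]
    rfl
  have hfix : ∀ f, (T ^ p ^ n) f = f ↔ ∃ g : Fin s → V, g ∘ π = f := by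
    intro f
    rw [hT]
    constructor
    · intro h
      have hk : ∀ (k : ℕ) a, f (((σ ^ p ^ n) ^ k) a) = f a := by
        intro k
        induction k with
        | zero => simp
        | succ k ih =>
          intro a
          rw [pow_succ', Equiv.Perm.mul_apply]
          exact (congrFun h _).trans (ih a)
      refine ⟨fun j => f (Function.surjInv hπ j), funext fun a => ?_⟩
      obtain ⟨k, hka⟩ := horb a _ (Function.surjInv_eq hπ (π a)).symm
      rw [Function.comp_apply, ← hka, hk]
    · rintro ⟨g, rfl⟩
      exact funext fun a => congrArg g (hinv a)
  obtain ⟨κ, hκ⟩ := exists_zmod_label hp T hT1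
  let e : ZMod (p ^ (n + 1)) ≃ Fin (p ^ (n + 1)) := Fintype.equivFinOfCardEq (ZMod.card _)
  refine ⟨fun f => if (T ^ p ^ n) f = f then χ (f ∘ Function.surjInv hπ) else e (κ f),
    fun E i => ?_⟩
  set A := Fintype.piFinset fun _ : Fin d => E with hA
  set B := Fintype.piFinset fun _ : Fin s => E with hB
  have hmem : ∀ g : Fin s → V, g ∘ π ∈ A ↔ g ∈ B := by
    intro g
    simp only [hA, hB, Fintype.mem_piFinset, Function.comp_apply]
    exact (hπ.forall (p := fun j => g j ∈ E)).symm
  have hinj : Function.Injective fun g : Fin s → V => g ∘ π := hπ.injective_comp_right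
  have hsec : ∀ g : Fin s → V, (g ∘ π) ∘ Function.surjInv hπ = g := fun g =>
    funext fun j => congrArg g (Function.surjInv_eq hπ j)
  have hper : (A.filter fun f => (T ^ p ^ n) f = f).card = B.card := by
    symm
    refine Finset.card_nbij (fun g => g ∘ π) ?_ hinj.injOn ?_
    · intro g hg
      exact Finset.mem_filter.2 ⟨(hmem g).2 hg, (hfix _).2 ⟨g, rfl⟩⟩
    · intro f hf
      obtain ⟨hf1, hf2⟩ := Finset.mem_filter.1 hf
      obtain ⟨g, rfl⟩ := (hfix f).1 hf2
      exact ⟨g, (hmem g).1 hf1, rfl⟩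
  have hperi : (A.filter fun f => (T ^ p ^ n) f = f ∧ χ (f ∘ Function.surjInv hπ) = i).card
      = (B.filter fun g => χ g = i).card := by
    symm
    refine Finset.card_nbij (fun g => g ∘ π) ?_ hinj.injOn ?_
    · intro g hg
      obtain ⟨hg1, hg2⟩ := Finset.mem_filter.1 hg
      exact Finset.mem_filter.2
        ⟨(hmem g).2 hg1, (hfix _).2 ⟨g, rfl⟩, by rw [hsec]; exact hg2⟩
    · intro f hf
      obtain ⟨hf1, hf2, hf3⟩ := Finset.mem_filter.1 hf
      obtain ⟨g, rfl⟩ := (hfix f).1 hf2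
      rw [hsec] at hf3
      exact ⟨g, Finset.mem_filter.2 ⟨(hmem g).1 hf1, hf3⟩, rfl⟩
  have hfree : p ^ (n + 1) * (A.filter fun f => ¬ (T ^ p ^ n) f = f ∧ e (κ f) = i).card
      = (A.filter fun f => ¬ (T ^ p ^ n) f = f).card := by
    have h := card_mul_filter_label (A.filter fun f => ¬ (T ^ p ^ n) f = f) T
      (fun f => ?_) κ (fun f hf => hκ f (Finset.mem_filter.1 hf).2) (e.symm i)
    · rw [← h, Finset.filter_filter]
      simp only [Equiv.eq_symm_apply]
    · have h1 : (T ^ p ^ n) (T f) = T f ↔ (T ^ p ^ n) f = f := by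
        rw [← Equiv.Perm.mul_apply, ← pow_succ, pow_succ', Equiv.Perm.mul_apply,
          T.injective.eq_iff]
      have h2 : T f ∈ A ↔ f ∈ A := by
        simp only [hA, Fintype.mem_piFinset]
        exact (σ.surjective.forall (p := fun j => f j ∈ E)).symm
      rw [Finset.mem_filter, Finset.mem_filter, h1, h2]
  have hsplit : (A.filter fun f =>
        (if (T ^ p ^ n) f = f then χ (f ∘ Function.surjInv hπ) else e (κ f)) = i).card
      = (A.filter fun f => (T ^ p ^ n) f = f ∧ χ (f ∘ Function.surjInv hπ) = i).card
        + (A.filter fun f => ¬ (T ^ p ^ n) f = f ∧ e (κ f) = i).card := by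
    rw [← Finset.card_filter_add_card_filter_not (fun f => (T ^ p ^ n) f = f),
      Finset.filter_filter, Finset.filter_filter]
    congr 2 <;> ext f <;> by_cases h : (T ^ p ^ n) f = f <;> simp [h]
  have htot : A.card = B.card + (A.filter fun f => ¬ (T ^ p ^ n) f = f).card := by
    rw [← hper, Finset.card_filter_add_card_filter_not]
  have hc : ((p ^ (n + 1) : ℕ) : ℝ) ≠ 0 := Nat.cast_ne_zero.2 (pow_ne_zero _ hp.ne_zero)
  rw [hsplit, hperi, htot, ← hfree]
  push_cast at hc ⊢
  field_simp
  ring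

theorem discCol_nonneg {V : Type} (H : Finset (Finset V)) (c : ℕ) (χ : V → Fin c) :
    0 ≤ discCol H c χ :=
  Real.iSup_nonneg fun _ => Real.iSup_nonneg fun _ => Real.iSup_nonneg fun _ => abs_nonneg _

theorem le_discCol {V : Type} [Finite V] {H : Finset (Finset V)} {c : ℕ} (χ : V → Fin c)
    {E : Finset V} (hE : E ∈ H) (i : Fin c) :
    |((E.filter fun v => χ v = i).card : ℝ) - (E.card : ℝ) / (c : ℝ)| ≤ discCol H c χ := by
  refine le_trans ?_ (le_ciSup (Set.finite_range _).bddAbove E)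
  rw [ciSup_pos hE]
  exact le_ciSup (f := fun i => |((E.filter fun v => χ v = i).card : ℝ) - (E.card : ℝ) / (c : ℝ)|)
    (Set.finite_range _).bddAbove i

theorem discCol_le {V : Type} {H : Finset (Finset V)} {c : ℕ} {χ : V → Fin c} {b : ℝ}
    (hb : 0 ≤ b) (h : ∀ E ∈ H, ∀ i : Fin c,
      |((E.filter fun v => χ v = i).card : ℝ) - (E.card : ℝ) / (c : ℝ)| ≤ b) :
    discCol H c χ ≤ b :=
  Real.iSup_le (fun E => Real.iSup_le (fun hE => Real.iSup_le (h E hE) hb) hb) hb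

/-- For `c = p^q` a prime power, `d ≥ c` and `s = d - (p-1)p^(q-1)`, every hypergraph
satisfies `disc(Δ^d H, c) ≤ disc(Δ^s H, c)`. -/
theorem stmt8 (p q d : ℕ) (hp : p.Prime) (hq : 1 ≤ q) (hd : p ^ q ≤ d)
    (V : Type) [Fintype V] [DecidableEq V] (H : Finset (Finset V)) :
    disc (symProd H d) (p ^ q) ≤ disc (symProd H (d - (p - 1) * p ^ (q - 1))) (p ^ q) := by
  obtain ⟨n, rfl⟩ := Nat.exists_eq_add_of_le' hq
  have := Fact.mk hp
  refine le_ciInf fun χ => ?_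
  obtain ⟨χ', hχ'⟩ := exists_lift_coloring hp hd rfl χ
  refine le_trans (ciInf_le ⟨0, ?_⟩ χ') ?_
  · rintro _ ⟨ψ, rfl⟩
    exact discCol_nonneg _ _ ψ
  · refine discCol_le (discCol_nonneg _ _ χ) fun F hF i => ?_
    rw [symProd, Finset.mem_image] at hF
    obtain ⟨E, hE, rfl⟩ := hF
    rw [hχ' E i]
    have hmem : (Fintype.piFinset fun _ => E) ∈ symProd H (d - (p - 1) * p ^ n) :=
      Finset.mem_image_of_mem _ hE
    exact le_discCol χ hmem i
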